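/- arXiv:2003.07243 — 8 statements merged into one kernel-verified Lean document; each statement's English description precedes it below -/
import Mathlib

section
/- Let H, K : E → ℝ be differentiable functions admitting continuously differentiable Hamiltonian vector fields X_H, X_K. Then the Poisson bracket {H,K}(x) = ω(X_H(x), X_K(x)) is differentiable and its derivative satisfies D{H,K}(x)(v) = −ω([X_H, X_K](x), v) for all x, v ∈ E. -/
/-- The derivative of a Hamiltonian vector field is symmetric with respect to the bilinear form,
because it represents the second derivative of the Hamiltonian. -/
theorem HasFDerivAt.hamiltonian_symmetric {E : Type*} [NormedAddCommGroup E] [NormedSpace ℝ E]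
    (B : E →L[ℝ] E →L[ℝ] ℝ) {H : E → ℝ} (hH : Differentiable ℝ H) {X : E → E}
    (hX : ∀ x v, B (X x) v = -fderiv ℝ H x v) {X' : E →L[ℝ] E} {x : E}
    (hX' : HasFDerivAt X X' x) (v w : E) : B (X' v) w = B (X' w) v := by
  have h : ∀ y, HasFDerivAt (fun z => -H z) (B (X y)) y := fun y => by
    rw [show B (X y) = -fderiv ℝ H y from ContinuousLinearMap.ext (hX y)]
    exact (hH y).hasFDerivAt.neg
  exact second_derivative_symmetric h (B.hasFDerivAt.comp x hX') v w

/-- The Poisson bracket `{H,K}(x) = ω(X_H(x), X_K(x))` of differentiable functions with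
`C¹` Hamiltonian vector fields is differentiable, and its derivative is
`δ{H,K}(x)(v) = -ω([X_H, X_K](x), v)`, where `[V,W](x) = DW(x)(V(x)) - DV(x)(W(x))`. -/
theorem fderiv_poisson_bracket {E : Type*} [NormedAddCommGroup E] [NormedSpace ℝ E]
    [FiniteDimensional ℝ E]
    (ω : E →ₗ[ℝ] E →ₗ[ℝ] ℝ) (halt : ∀ v, ω v v = 0)
    (H K : E → ℝ) (hH : Differentiable ℝ H) (hK : Differentiable ℝ K)
    (XH XK : E → E) (hXHs : ContDiff ℝ 1 XH) (hXKs : ContDiff ℝ 1 XK)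
    (hXH : ∀ x v, ω (XH x) v = - fderiv ℝ H x v)
    (hXK : ∀ x v, ω (XK x) v = - fderiv ℝ K x v) :
    Differentiable ℝ (fun x => ω (XH x) (XK x)) ∧
    ∀ x v, fderiv ℝ (fun x => ω (XH x) (XK x)) x v
      = - ω (fderiv ℝ XK x (XH x) - fderiv ℝ XH x (XK x)) v := by
  let B : E →L[ℝ] E →L[ℝ] ℝ := LinearMap.toContinuousBilinearMap ω
  have hXH' x := (hXHs.differentiable one_ne_zero x).hasFDerivAt
  have hXK' x := (hXKs.differentiable one_ne_zero x).hasFDerivAt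
  have hB x := B.hasFDerivAt_of_bilinear (hXH' x) (hXK' x)
  refine ⟨fun x => (hB x).differentiableAt, fun x v => ?_⟩
  have h₁ : ω (fderiv ℝ XH x v) (XK x) = ω (fderiv ℝ XH x (XK x)) v :=
    (hXH' x).hamiltonian_symmetric B hH hXH v (XK x)
  have h₂ : ω (fderiv ℝ XK x v) (XH x) = ω (fderiv ℝ XK x (XH x)) v :=
    (hXK' x).hamiltonian_symmetric B hK hXK v (XH x)
  have h₃ : -ω (XH x) (fderiv ℝ XK x v) = ω (fderiv ℝ XK x v) (XH x) :=
    LinearMap.IsAlt.neg halt _ _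
  have h₄ : fderiv ℝ (fun x => ω (XH x) (XK x)) x v
      = ω (XH x) (fderiv ℝ XK x v) + ω (fderiv ℝ XH x v) (XK x) :=
    DFunLike.congr_fun (hB x).fderiv v
  rw [h₄, map_sub, LinearMap.sub_apply]
  linarith
end

section
/- Let H, K : E → ℝ be differentiable functions admitting continuously differentiable Hamiltonian vector fields X_H, X_K, and suppose ω is nondegenerate. If Z : E → E is a Hamiltonian vector field for the Poisson bracket {H,K}, i.e. ω(Z(x), v) = −D{H,K}(x)(v) for all x, v ∈ E, then Z = [X_H, X_K]; that is, the assignment of Hamiltonian functions to Hamiltonian vector fields is a Lie algebra homomorphism, X_{{H,K}} = [X_H, X_K]. -/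
/-- The derivative of a differentiable Hamiltonian vector field is symmetric with respect
to the form, since it represents the Hessian of the Hamiltonian. -/
theorem form_fderiv_hamiltonianVectorField_comm {E : Type*} [NormedAddCommGroup E]
    [NormedSpace ℝ E] (L : E →L[ℝ] E →L[ℝ] ℝ) {H : E → ℝ} {X : E → E}
    (hH : Differentiable ℝ H) {x : E} (hX : DifferentiableAt ℝ X x)
    (hXH : ∀ x v, L (X x) v = - fderiv ℝ H x v) (v w : E) :
    L (fderiv ℝ X x v) w = L (fderiv ℝ X x w) v := by
  have h₁ : ∀ y, HasFDerivAt (fun y => - H y) (L (X y)) y := fun y => by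
    have h : L (X y) = - fderiv ℝ H y := by
      ext v
      simp [hXH]
    rw [h]
    exact (hH y).hasFDerivAt.fun_neg
  have h₂ : HasFDerivAt (fun y => L (X y)) (L.comp (fderiv ℝ X x)) x :=
    L.hasFDerivAt.comp x hX.hasFDerivAt
  exact second_derivative_symmetric h₁ h₂ v w

/-- If `ω` is nondegenerate and `Z` is a Hamiltonian vector field for the Poisson
bracket `{H,K}`, then `Z = [X_H, X_K]`: the map from Hamiltonian functions to
Hamiltonian vector fields is a Lie algebra homomorphism. -/
theorem hamiltonianVectorField_poisson_bracket {E : Type*} [NormedAddCommGroup E]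
    [NormedSpace ℝ E] [FiniteDimensional ℝ E]
    (ω : E →ₗ[ℝ] E →ₗ[ℝ] ℝ) (halt : ∀ v, ω v v = 0)
    (hnd : ∀ v : E, (∀ w : E, ω v w = 0) → v = 0)
    (H K : E → ℝ) (hH : Differentiable ℝ H) (hK : Differentiable ℝ K)
    (XH XK : E → E) (hXHs : ContDiff ℝ 1 XH) (hXKs : ContDiff ℝ 1 XK)
    (hXH : ∀ x v, ω (XH x) v = - fderiv ℝ H x v)
    (hXK : ∀ x v, ω (XK x) v = - fderiv ℝ K x v)
    (Z : E → E)
    (hZ : ∀ x v, ω (Z x) v = - fderiv ℝ (fun y => ω (XH y) (XK y)) x v) :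
    Z = fun x => fderiv ℝ XK x (XH x) - fderiv ℝ XH x (XK x) := by
  let L : E →L[ℝ] E →L[ℝ] ℝ := LinearMap.toContinuousLinearMap
    ((LinearMap.toContinuousLinearMap : (E →ₗ[ℝ] ℝ) ≃ₗ[ℝ] E →L[ℝ] ℝ).toLinearMap ∘ₗ ω)
  have hL : ∀ v w, L v w = ω v w := fun _ _ => rfl
  have hneg : ∀ v w, ω v w = - ω w v := fun v w => by
    have h := halt (v + w)
    simp only [map_add, LinearMap.add_apply, halt] at h
    linarith
  funext x
  have hdH : DifferentiableAt ℝ XH x := hXHs.differentiable one_ne_zero x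
  have hdK : DifferentiableAt ℝ XK x := hXKs.differentiable one_ne_zero x
  have hbracket : ∀ v, fderiv ℝ (fun y => ω (XH y) (XK y)) x v
      = ω (XH x) (fderiv ℝ XK x v) + ω (fderiv ℝ XH x v) (XK x) := fun v => by
    have h := L.hasFDerivAt_of_bilinear hdH.hasFDerivAt hdK.hasFDerivAt
    simp only [hL] at h
    rw [h.fderiv]
    rfl
  refine sub_eq_zero.mp (hnd _ fun v => ?_)
  have hsymmH := form_fderiv_hamiltonianVectorField_comm L hH hdH hXH v (XK x)
  have hsymmK := form_fderiv_hamiltonianVectorField_comm L hK hdK hXK v (XH x)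
  simp only [hL] at hsymmH hsymmK
  simp only [map_sub, LinearMap.sub_apply, hZ, hbracket]
  linarith [hneg (XH x) (fderiv ℝ XK x v)]
end

section
/- For all C^∞ functions H, K, L : E → ℝ the Jacobi identity holds: {H,{K,L}} + {L,{H,K}} + {K,{L,H}} = 0, where {f,g}(x) = ω(X_f(x), X_g(x)) and X_f denotes the unique Hamiltonian vector field of f. -/
/-- A Hamiltonian vector field of a `C²` function `f` is differentiable, and its derivative
corresponds through `ω` to minus the second derivative of `f`. -/
theorem exists_hasFDerivAt_hamiltonianVectorField {E : Type*} [NormedAddCommGroup E]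
    [NormedSpace ℝ E] [FiniteDimensional ℝ E] (ω : E →ₗ[ℝ] E →ₗ[ℝ] ℝ)
    (hnd : ∀ v : E, (∀ w : E, ω v w = 0) → v = 0) {f : E → ℝ} (hf : ContDiff ℝ 2 f) {X : E → E}
    (hX : ∀ x v, ω (X x) v = - fderiv ℝ f x v) (x : E) :
    ∃ X' : E →L[ℝ] E, HasFDerivAt X X' x ∧
      ∀ v w, ω (X' v) w = - fderiv ℝ (fderiv ℝ f) x v w := by
  let B : E →ₗ[ℝ] E →L[ℝ] ℝ := LinearMap.toContinuousLinearMap.toLinearMap ∘ₗ ω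
  have hB : LinearMap.ker B = ⊥ := by
    refine LinearMap.ker_eq_bot'.2 fun v hv => hnd v fun w => ?_
    exact congrArg (fun l : E →L[ℝ] ℝ => l w) hv
  obtain ⟨S, hS⟩ := LinearMap.exists_leftInverse_of_injective B hB
  have hBX (y : E) : B (X y) = -fderiv ℝ f y := by
    ext v
    exact hX y v
  have hX_eq : X = fun y => S.toContinuousLinearMap (-fderiv ℝ f y) := by
    funext y
    rw [← hBX]
    exact (LinearMap.congr_fun hS (X y)).symm
  have hd : HasFDerivAt (fun y => -fderiv ℝ f y) (-fderiv ℝ (fderiv ℝ f) x) x :=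
    ((hf.fderiv_right (m := 1) (by norm_num)).differentiable one_ne_zero x).hasFDerivAt.neg
  have hX' : HasFDerivAt X (S.toContinuousLinearMap.comp (-fderiv ℝ (fderiv ℝ f) x)) x := by
    rw [hX_eq]
    exact S.toContinuousLinearMap.hasFDerivAt.comp x hd
  refine ⟨_, hX', fun v w => ?_⟩
  have hBX' := (B.toContinuousLinearMap.hasFDerivAt (x := X x)).comp x hX'
  have h_eq : B.toContinuousLinearMap ∘ X = fun y => -fderiv ℝ f y := funext hBX
  rw [h_eq] at hBX'
  exact congrArg (fun l : E →L[ℝ] E →L[ℝ] ℝ => l v w) (hBX'.unique hd)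

/-- The derivative of the Poisson bracket of two `C²` functions. -/
theorem fderiv_poissonBracket_apply {E : Type*} [NormedAddCommGroup E]
    [NormedSpace ℝ E] [FiniteDimensional ℝ E] (ω : E →ₗ[ℝ] E →ₗ[ℝ] ℝ) (halt : ∀ v, ω v v = 0)
    (hnd : ∀ v : E, (∀ w : E, ω v w = 0) → v = 0) {f g : E → ℝ} (hf : ContDiff ℝ 2 f)
    (hg : ContDiff ℝ 2 g) {X Y : E → E} (hX : ∀ x v, ω (X x) v = - fderiv ℝ f x v)
    (hY : ∀ x v, ω (Y x) v = - fderiv ℝ g x v) (x v : E) :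
    fderiv ℝ (fun y => ω (X y) (Y y)) x v =
      fderiv ℝ (fderiv ℝ g) x v (X x) - fderiv ℝ (fderiv ℝ f) x v (Y x) := by
  obtain ⟨X', hX', hωX'⟩ := exists_hasFDerivAt_hamiltonianVectorField ω hnd hf hX x
  obtain ⟨Y', hY', hωY'⟩ := exists_hasFDerivAt_hamiltonianVectorField ω hnd hg hY x
  let B : E →L[ℝ] E →L[ℝ] ℝ :=
    (LinearMap.toContinuousLinearMap.toLinearMap ∘ₗ ω).toContinuousLinearMap
  have h : fderiv ℝ (fun y => ω (X y) (Y y)) x v = ω (X x) (Y' v) + ω (X' v) (Y x) := by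
    have hB : HasFDerivAt (fun y => ω (X y) (Y y)) _ x := B.hasFDerivAt_of_bilinear hX' hY'
    rw [hB.fderiv]
    rfl
  have hω : LinearMap.IsAlt ω := halt
  rw [h, hωX', ← hω.neg, hωY']
  ring

/-- Jacobi identity for the Poisson bracket: for smooth `H, K, L` with (necessarily
unique, by nondegeneracy) Hamiltonian vector fields, and Hamiltonian vector fields of
the nested brackets, `{H,{K,L}} + {L,{H,K}} + {K,{L,H}} = 0`. -/
theorem poisson_jacobi_identity {E : Type*} [NormedAddCommGroup E] [NormedSpace ℝ E]
    [FiniteDimensional ℝ E]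
    (ω : E →ₗ[ℝ] E →ₗ[ℝ] ℝ) (halt : ∀ v, ω v v = 0)
    (hnd : ∀ v : E, (∀ w : E, ω v w = 0) → v = 0)
    (H K L : E → ℝ) (hH : ContDiff ℝ (⊤ : ℕ∞) H) (hK : ContDiff ℝ (⊤ : ℕ∞) K) (hL : ContDiff ℝ (⊤ : ℕ∞) L)
    (XH XK XL XKL XHK XLH : E → E)
    (hXH : ∀ x v, ω (XH x) v = - fderiv ℝ H x v)
    (hXK : ∀ x v, ω (XK x) v = - fderiv ℝ K x v)
    (hXL : ∀ x v, ω (XL x) v = - fderiv ℝ L x v)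
    (hXKL : ∀ x v, ω (XKL x) v = - fderiv ℝ (fun y => ω (XK y) (XL y)) x v)
    (hXHK : ∀ x v, ω (XHK x) v = - fderiv ℝ (fun y => ω (XH y) (XK y)) x v)
    (hXLH : ∀ x v, ω (XLH x) v = - fderiv ℝ (fun y => ω (XL y) (XH y)) x v) :
    ∀ x, ω (XH x) (XKL x) + ω (XL x) (XHK x) + ω (XK x) (XLH x) = 0 := by
  have h_neg (v w : E) : ω v w = -ω w v := (LinearMap.IsAlt.neg (B := ω) halt w v).symm
  have hH₂ : ContDiff ℝ 2 H := contDiff_infty.1 hH 2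
  have hK₂ : ContDiff ℝ 2 K := contDiff_infty.1 hK 2
  have hL₂ : ContDiff ℝ 2 L := contDiff_infty.1 hL 2
  have h_symm {f : E → ℝ} (hf : ContDiff ℝ 2 f) (x v w : E) :
      fderiv ℝ (fderiv ℝ f) x v w = fderiv ℝ (fderiv ℝ f) x w v :=
    (hf.contDiffAt.isSymmSndFDerivAt (by simp)).eq v w
  intro x
  rw [h_neg (XH x), h_neg (XL x), h_neg (XK x), hXKL, hXHK, hXLH,
    fderiv_poissonBracket_apply ω halt hnd hK₂ hL₂ hXK hXL,
    fderiv_poissonBracket_apply ω halt hnd hH₂ hK₂ hXH hXK,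
    fderiv_poissonBracket_apply ω halt hnd hL₂ hH₂ hXL hXH,
    h_symm hH₂ x (XL x), h_symm hK₂ x (XH x), h_symm hL₂ x (XK x)]
  ring
end

section
/- Let H : E → ℝ be a differentiable function admitting a continuously differentiable Hamiltonian vector field X_H. Let γ : ℝ → E be differentiable with γ′(t) = X_H(γ(t)) for all t, and let u, v : ℝ → E be differentiable solutions of the linearized equations u′(t) = DX_H(γ(t))(u(t)) and v′(t) = DX_H(γ(t))(v(t)) for all t. Then the function t ↦ ω(u(t), v(t)) is constant on ℝ; i.e., the flow generated by a Hamiltonian vector field preserves the symplectic form (is a symplectomorphism). -/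
/-- The linearization `DX_H` of a Hamiltonian vector field is infinitesimally symplectic. -/
theorem hamiltonian_linearization_symplectic {E : Type*} [NormedAddCommGroup E]
    [NormedSpace ℝ E] (B : E →L[ℝ] E →L[ℝ] ℝ) (halt : ∀ w, B w w = 0)
    {H : E → ℝ} (hH : Differentiable ℝ H) {XH : E → E} {x : E} (hX : DifferentiableAt ℝ XH x)
    (hXH : ∀ y w, B (XH y) w = - fderiv ℝ H y w) (a b : E) :
    B a (fderiv ℝ XH x b) + B (fderiv ℝ XH x a) b = 0 := by
  have hH' (y : E) : HasFDerivAt H (-B (XH y)) y := by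
    convert (hH y).hasFDerivAt using 1
    ext w
    simp [hXH]
  have hH'' : HasFDerivAt (fun y ↦ -B (XH y)) (-(B.comp (fderiv ℝ XH x))) x :=
    (B.hasFDerivAt.comp x hX.hasFDerivAt).neg
  have hsymm : B (fderiv ℝ XH x a) b = B (fderiv ℝ XH x b) a := by
    simpa using second_derivative_symmetric hH' hH'' a b
  have hsum := halt (a + fderiv ℝ XH x b)
  simp only [map_add, add_apply, halt] at hsum
  linarith

/-- The flow of a Hamiltonian vector field preserves the symplectic form: if `u`, `v`
solve the equations linearized along an integral curve `γ` of `X_H`, then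
`t ↦ ω(u t, v t)` is constant. -/
theorem hamiltonian_flow_preserves_symplectic_form {E : Type*} [NormedAddCommGroup E]
    [NormedSpace ℝ E] [FiniteDimensional ℝ E]
    (ω : E →ₗ[ℝ] E →ₗ[ℝ] ℝ) (halt : ∀ w, ω w w = 0)
    (H : E → ℝ) (hH : Differentiable ℝ H)
    (XH : E → E) (hXHs : ContDiff ℝ 1 XH)
    (hXH : ∀ x w, ω (XH x) w = - fderiv ℝ H x w)
    (γ : ℝ → E) (hγ : Differentiable ℝ γ) (hγ' : ∀ t, deriv γ t = XH (γ t))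
    (u v : ℝ → E) (hu : Differentiable ℝ u) (hv : Differentiable ℝ v)
    (hu' : ∀ t, deriv u t = fderiv ℝ XH (γ t) (u t))
    (hv' : ∀ t, deriv v t = fderiv ℝ XH (γ t) (v t)) :
    ∀ s t : ℝ, ω (u s) (v s) = ω (u t) (v t) := by
  have hderiv (t : ℝ) : HasDerivAt (fun r ↦ ω (u r) (v r)) 0 t := by
    have hsum := ω.toContinuousBilinearMap.hasDerivAt_of_bilinear
      (fun _ ↦ (hu t).hasDerivAt) (fun _ ↦ (hv t).hasDerivAt)
    rwa [hu', hv', hamiltonian_linearization_symplectic ω.toContinuousBilinearMap halt hH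
      (hXHs.differentiable one_ne_zero (γ t)) hXH] at hsum
  exact is_const_of_deriv_eq_zero (fun t ↦ (hderiv t).differentiableAt) fun t ↦ (hderiv t).deriv
end

section
/- If f : ℝ → ℝ is continuously differentiable and ∫₀¹ (f′(x)·g(x) − f(x)·g′(x)) dx = 0 for every C^∞ function g : ℝ → ℝ, then f(x) = 0 for every x ∈ [0,1]. (This expresses that the presymplectic form Ω(δφ₁, δφ₂) = ∫₀¹ (∂ₓδφ₁·δφ₂ − ∂ₓδφ₂·δφ₁) dx on functions on the interval [0,1] is weakly nondegenerate.) -/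
open intervalIntegral

/-- A `C¹` function whose derivative annihilates every smooth function compactly supported in
`(0,1)` has almost everywhere vanishing derivative on `(0,1]`. -/
theorem ae_deriv_eq_zero_of_integral_deriv_mul_eq_zero {f : ℝ → ℝ} (hf : ContDiff ℝ 1 f)
    (h : ∀ g : ℝ → ℝ, ContDiff ℝ (⊤ : ℕ∞) g → tsupport g ⊆ Set.Ioo 0 1 →
      (∫ x in (0:ℝ)..1, deriv f x * g x) = 0) :
    ∀ᵐ x : ℝ, x ∈ Set.Ioc (0:ℝ) 1 → deriv f x = 0 := by
  have hcont : Continuous (deriv f) := hf.continuous_deriv le_rfl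
  have hae := isOpen_Ioo.ae_eq_zero_of_integral_contDiff_smul_eq_zero (U := Set.Ioo (0:ℝ) 1)
    (f := deriv f) (μ := MeasureTheory.volume) (hcont.locallyIntegrable.locallyIntegrableOn _)
    (fun g hg _ hsupp => by
      rw [← h g hg hsupp, integral_of_le zero_le_one,
        MeasureTheory.setIntegral_eq_integral_of_forall_compl_eq_zero]
      · simp only [smul_eq_mul, mul_comm]
      · intro x hx
        have hgx : g x = 0 := image_eq_zero_of_notMem_tsupport
          fun hx' => hx (Set.Ioo_subset_Ioc_self (hsupp hx'))
        rw [hgx, mul_zero])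
  filter_upwards [hae, MeasureTheory.Measure.ae_ne MeasureTheory.volume (1:ℝ)] with x hx hne hmem
  exact hx ⟨hmem.1, lt_of_le_of_ne hmem.2 hne⟩

/-- Weak nondegeneracy of the presymplectic form on functions on `[0,1]`: if `f` is `C¹`
and `∫₀¹ (f' g - f g') = 0` for every smooth `g`, then `f` vanishes on `[0,1]`. -/
theorem weakly_nondegenerate_interval (f : ℝ → ℝ) (hf : ContDiff ℝ 1 f)
    (h : ∀ g : ℝ → ℝ, ContDiff ℝ (⊤ : ℕ∞) g →
      (∫ x in (0:ℝ)..1, (deriv f x * g x - f x * deriv g x)) = 0) :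
    ∀ x ∈ Set.Icc (0:ℝ) 1, f x = 0 := by
  have hcont : Continuous (deriv f) := hf.continuous_deriv le_rfl
  have hderiv : ∀ x, HasDerivAt f (deriv f x) x := fun x =>
    (hf.differentiable one_ne_zero x).hasDerivAt
  have hae := ae_deriv_eq_zero_of_integral_deriv_mul_eq_zero hf fun g hg hsupp => by
    have hgcont : Continuous (deriv g) := hg.continuous_deriv (by simp)
    have hgderiv : ∀ x, HasDerivAt g (deriv g x) x := fun x =>
      (hg.differentiable (by simp) x).hasDerivAt
    have hparts := integral_deriv_mul_eq_sub (a := 0) (b := 1) (fun x _ => hderiv x)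
      (fun x _ => hgderiv x) (hcont.intervalIntegrable 0 1) (hgcont.intervalIntegrable 0 1)
    have hg0 : g 0 = 0 := image_eq_zero_of_notMem_tsupport fun hx => (hsupp hx).1.false
    have hg1 : g 1 = 0 := image_eq_zero_of_notMem_tsupport fun hx => (hsupp hx).2.false
    have hint : IntervalIntegrable (fun x => deriv f x * g x) MeasureTheory.volume 0 1 :=
      (hcont.mul hg.continuous).intervalIntegrable 0 1
    have hint' : IntervalIntegrable (fun x => f x * deriv g x) MeasureTheory.volume 0 1 :=
      (hf.continuous.mul hgcont).intervalIntegrable 0 1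
    have hform := h g hg
    rw [integral_add hint hint', hg0, hg1] at hparts
    rw [integral_sub hint hint'] at hform
    linarith
  have hconst : ∀ x ∈ Set.Icc (0:ℝ) 1, f x = f 0 := by
    intro x hx
    rw [← sub_eq_zero, ← integral_eq_sub_of_hasDerivAt (fun y _ => hderiv y)
      (hcont.intervalIntegrable 0 x)]
    apply integral_zero_ae
    filter_upwards [hae] with y hy hmem
    rw [Set.uIoc_of_le hx.1] at hmem
    exact hy ⟨hmem.1, hmem.2.trans hx.2⟩
  have hzero : f 0 = 0 := by
    have hid := h id contDiff_id
    rw [integral_congr_ae (g := fun _ => -f 0)] at hid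
    · simpa using hid
    · filter_upwards [hae] with x hx hmem
      rw [Set.uIoc_of_le zero_le_one] at hmem
      simp [hx hmem, hconst x (Set.Ioc_subset_Icc_self hmem)]
  intro x hx
  rw [hconst x hx, hzero]
end

section
/- Let n be a natural number, let F : (Fin n → ℝ) → Fin n → Fin n → ℝ be C^∞ with F(x)(μ)(ν) = −F(x)(ν)(μ) for all x, μ, ν, and let j : (Fin n → ℝ) → Fin n → ℝ be C^∞ with Σ_μ ∂_μ(j(·)(μ))(x) = 0 for all x, where ∂_μ denotes the partial derivative in the μ-th coordinate direction. Define E(x)(μ) = Σ_ν ∂_ν(F(·)(ν)(μ))(x) − j(x)(μ). Then Σ_μ ∂_μ(E(·)(μ))(x) = 0 for all x; i.e., the Maxwell field equations E^μ = ∂_ν F^{νμ} − j^μ are dependent. -/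
section

variable {V W : Type*} [NormedAddCommGroup V] [NormedSpace ℝ V] [NormedAddCommGroup W]
  [NormedSpace ℝ W]

theorem ContDiff.differentiable_fderiv_apply_const {f : V → W} (hf : ContDiff ℝ 2 f) (v : V) :
    Differentiable ℝ (fun y => fderiv ℝ f y v) :=
  ((hf.fderiv_right (m := 1) (by norm_num)).differentiable (by norm_num)).clm_apply
    (differentiable_const v)

theorem ContDiff.fderiv_fderiv_apply_comm {f : V → W} (hf : ContDiff ℝ 2 f) (x v w : V) :
    fderiv ℝ (fun y => fderiv ℝ f y v) x w = fderiv ℝ (fun y => fderiv ℝ f y w) x v := by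
  have hd : DifferentiableAt ℝ (fderiv ℝ f) x :=
    (hf.fderiv_right (m := 1) (by norm_num)).differentiable (by norm_num) x
  have key (u : V) : fderiv ℝ (fun y => fderiv ℝ f y u) x = (fderiv ℝ (fderiv ℝ f) x).flip u := by
    rw [fderiv_clm_apply hd (differentiableAt_const u)]
    simp
  rw [key, key]
  exact (hf.contDiffAt.isSymmSndFDerivAt (by simp)) w v

end

/-- The double divergence of an antisymmetric `C^2` tensor field vanishes. -/
theorem sum_sum_fderiv_fderiv_eq_zero_of_antisymm {n : ℕ}
    {F : (Fin n → ℝ) → Fin n → Fin n → ℝ} (hF : ∀ μ ν, ContDiff ℝ 2 (fun x => F x μ ν))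
    (hFanti : ∀ x μ ν, F x μ ν = - F x ν μ) (x : Fin n → ℝ) :
    ∑ μ, ∑ ν, fderiv ℝ (fun y => fderiv ℝ (fun z => F z ν μ) y (Pi.single ν 1)) x
      (Pi.single μ 1) = 0 := by
  refine self_eq_neg.mp ?_
  conv_lhs => rw [Finset.sum_comm]
  simp only [← Finset.sum_neg_distrib]
  refine Finset.sum_congr rfl fun μ _ => Finset.sum_congr rfl fun ν _ => ?_
  rw [(hF μ ν).fderiv_fderiv_apply_comm]
  have h : (fun z => F z μ ν) = fun z => -F z ν μ := funext fun z => hFanti z μ ν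
  simp [h, fderiv_fun_neg]


/-- Maxwell's equations `E^μ = ∂_ν F^{νμ} - j^μ` with antisymmetric `F` and conserved
current `j` are dependent: `∂_μ E^μ = 0`. -/
theorem maxwell_equations_dependent (n : ℕ)
    (F : (Fin n → ℝ) → Fin n → Fin n → ℝ)
    (hF : ∀ μ ν, ContDiff ℝ (⊤ : ℕ∞) (fun x => F x μ ν))
    (hFanti : ∀ x μ ν, F x μ ν = - F x ν μ)
    (j : (Fin n → ℝ) → Fin n → ℝ)
    (hj : ∀ μ, ContDiff ℝ (⊤ : ℕ∞) (fun x => j x μ))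
    (hdivj : ∀ x, ∑ μ, fderiv ℝ (fun y => j y μ) x (Pi.single μ 1) = 0)
    (Efield : (Fin n → ℝ) → Fin n → ℝ)
    (hE : ∀ x μ, Efield x μ =
      (∑ ν, fderiv ℝ (fun y => F y ν μ) x (Pi.single ν 1)) - j x μ) :
    ∀ x, ∑ μ, fderiv ℝ (fun y => Efield y μ) x (Pi.single μ 1) = 0 := by
  intro x
  have hF2 (μ ν : Fin n) : ContDiff ℝ 2 (fun x => F x μ ν) :=
    contDiff_infty.mp (hF μ ν) 2
  have key (μ : Fin n) : fderiv ℝ (fun y => Efield y μ) x (Pi.single μ 1) =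
      (∑ ν, fderiv ℝ (fun y => fderiv ℝ (fun z => F z ν μ) y (Pi.single ν 1)) x (Pi.single μ 1))
        - fderiv ℝ (fun y => j y μ) x (Pi.single μ 1) := by
    have hd (ν : Fin n) : DifferentiableAt ℝ
        (fun y => fderiv ℝ (fun z => F z ν μ) y (Pi.single ν 1)) x :=
      (hF2 ν μ).differentiable_fderiv_apply_const _ x
    simp only [hE]
    rw [fderiv_fun_sub (DifferentiableAt.fun_sum fun ν _ => hd ν)
      ((hj μ).differentiable (by simp) x), fderiv_fun_sum fun ν _ => hd ν]
    simp
  simp only [key, Finset.sum_sub_distrib, hdivj, sub_zero]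
  exact sum_sum_fderiv_fderiv_eq_zero_of_antisymm hF2 hFanti x
end

section
/- The map Φ : ℝ × E → ℝ × E defined by Φ(t,x) = (t + V(x), x) is a global C^∞ diffeomorphism: Φ is C^∞, it is a bijection, and its inverse is the C^∞ map Ψ(t,x) = (t − V(x), x); moreover Φ(t,x) = (t,x) whenever ‖x‖ ≤ 1. (This shows that supertranslations extend to globally well-defined diffeomorphisms of Minkowski space.) -/
/-- A function `x ↦ T x * s ‖x‖`, with `T` smooth away from the origin and `s` smooth and vanishing
on `(-∞, 1]`, extends smoothly by zero across the origin. -/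
theorem contDiff_of_eq_mul_comp_norm {F : Type*} [NormedAddCommGroup F] [InnerProductSpace ℝ F]
    {n : WithTop ℕ∞} {T : F → ℝ} (hT : ContDiffOn ℝ n T {(0 : F)}ᶜ)
    {s : ℝ → ℝ} (hs : ContDiff ℝ n s) (hs0 : ∀ r ≤ 1, s r = 0)
    {V : F → ℝ} (hV : ∀ x, x ≠ 0 → V x = T x * s ‖x‖) (hV0 : V 0 = 0) :
    ContDiff ℝ n V := by
  rw [contDiff_iff_contDiffAt]
  intro x
  by_cases hx : x = 0
  · subst hx
    refine (contDiffAt_const (c := (0 : ℝ))).congr_of_eventuallyEq ?_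
    filter_upwards [Metric.ball_mem_nhds (0 : F) one_pos] with y hy
    by_cases hy0 : y = 0
    · rw [hy0, hV0]
    · rw [hV y hy0, hs0 _ (mem_ball_zero_iff.mp hy).le, mul_zero]
  · have hx' : {(0 : F)}ᶜ ∈ nhds x := isOpen_compl_singleton.mem_nhds hx
    refine ((hT.contDiffAt hx').mul
      (hs.contDiffAt.comp x (contDiffAt_norm ℝ hx))).congr_of_eventuallyEq ?_
    filter_upwards [hx'] with y hy using hV y hy

/-- The supertranslation `Φ(t,x) = (t + V(x), x)` is a global smooth diffeomorphism of
`ℝ × E` with smooth inverse `Ψ(t,x) = (t - V(x), x)`, and it is the identity for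
`‖x‖ ≤ 1`. -/
theorem supertranslation_global_diffeomorphism (m : ℕ) (hm : 0 < m)
    (T : EuclideanSpace ℝ (Fin m) → ℝ)
    (hT : ContDiffOn ℝ (⊤ : ℕ∞) T {(0 : EuclideanSpace ℝ (Fin m))}ᶜ)
    (hThom : ∀ c : ℝ, 0 < c → ∀ x : EuclideanSpace ℝ (Fin m), x ≠ 0 → T (c • x) = T x)
    (s : ℝ → ℝ) (hs : ContDiff ℝ (⊤ : ℕ∞) s) (hs0 : ∀ r : ℝ, r ≤ 1 → s r = 0)
    (V : EuclideanSpace ℝ (Fin m) → ℝ)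
    (hV : ∀ x : EuclideanSpace ℝ (Fin m), x ≠ 0 → V x = T x * s ‖x‖)
    (hV0 : V 0 = 0)
    (Φ Ψ : ℝ × EuclideanSpace ℝ (Fin m) → ℝ × EuclideanSpace ℝ (Fin m))
    (hΦ : ∀ t x, Φ (t, x) = (t + V x, x))
    (hΨ : ∀ t x, Ψ (t, x) = (t - V x, x)) :
    ContDiff ℝ (⊤ : ℕ∞) Φ ∧ Function.Bijective Φ ∧ ContDiff ℝ (⊤ : ℕ∞) Ψ ∧
    (∀ p, Ψ (Φ p) = p) ∧ (∀ p, Φ (Ψ p) = p) ∧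
    (∀ (t : ℝ) (x : EuclideanSpace ℝ (Fin m)), ‖x‖ ≤ 1 → Φ (t, x) = (t, x)) := by
  have hVs : ContDiff ℝ (⊤ : ℕ∞) V := contDiff_of_eq_mul_comp_norm hT hs hs0 hV hV0
  have hΨΦ : Function.LeftInverse Ψ Φ := fun ⟨t, x⟩ => by rw [hΦ, hΨ, add_sub_cancel_right]
  have hΦΨ : Function.RightInverse Ψ Φ := fun ⟨t, x⟩ => by rw [hΨ, hΦ, sub_add_cancel]
  have hΦ_eq : Φ = fun p => (p.1 + V p.2, p.2) := funext fun ⟨t, x⟩ => hΦ t x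
  have hΨ_eq : Ψ = fun p => (p.1 - V p.2, p.2) := funext fun ⟨t, x⟩ => hΨ t x
  refine ⟨?_, ⟨hΨΦ.injective, hΦΨ.surjective⟩, ?_, hΨΦ, hΦΨ, fun t x hx => ?_⟩
  · rw [hΦ_eq]
    exact (contDiff_fst.add (hVs.comp contDiff_snd)).prodMk contDiff_snd
  · rw [hΨ_eq]
    exact (contDiff_fst.sub (hVs.comp contDiff_snd)).prodMk contDiff_snd
  · have hVx : V x = 0 := by
      by_cases hx0 : x = 0
      · rw [hx0, hV0]
      · rw [hV x hx0, hs0 _ hx, mul_zero]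
    rw [hΦ, hVx, add_zero]
end

section
/- Let m > 0 and J be real numbers and define F : ℝ³ → ℝ³ by F(u, r, φ) = ( (r/√m)·cosh(√m·φ) − (J/(2m))·sinh(√m·φ), (r/√m)·sinh(√m·φ) − (J/(2m))·cosh(√m·φ), (1/√m)·(−r + m·u + J·φ/2) ). Then for every (u, r, φ) ∈ ℝ³ and every tangent vector (a, b, c) ∈ ℝ³, writing (dT, dX, dY) = DF(u, r, φ)(a, b, c) for the Fréchet derivative of F applied to (a, b, c), one has −dT² + dX² + dY² = m·a² − 2·a·b + J·a·c + r²·c². (That is, the pullback of the Minkowski metric −dT² + dX² + dY² under F is the flat space cosmology metric m·du² − 2·du·dr + J·du·dφ + r²·dφ².) -/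
/-- The pullback of the Minkowski metric `-dT² + dX² + dY²` under the flat-space-cosmology
coordinate map `F(u,r,φ)` is the metric `m·du² - 2·du·dr + J·du·dφ + r²·dφ²`. -/
theorem flat_space_cosmology_metric (m J : ℝ) (hm : 0 < m)
    (F : ℝ × ℝ × ℝ → ℝ × ℝ × ℝ)
    (hF : ∀ u r φ : ℝ, F (u, r, φ) =
      ((r / Real.sqrt m) * Real.cosh (Real.sqrt m * φ)
          - (J / (2 * m)) * Real.sinh (Real.sqrt m * φ),
       (r / Real.sqrt m) * Real.sinh (Real.sqrt m * φ)
          - (J / (2 * m)) * Real.cosh (Real.sqrt m * φ),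
       (1 / Real.sqrt m) * (-r + m * u + J * φ / 2))) :
    ∀ u r φ a b c : ℝ,
      - (fderiv ℝ F (u, r, φ) (a, b, c)).1 ^ 2
        + (fderiv ℝ F (u, r, φ) (a, b, c)).2.1 ^ 2
        + (fderiv ℝ F (u, r, φ) (a, b, c)).2.2 ^ 2
      = m * a ^ 2 - 2 * a * b + J * a * c + r ^ 2 * c ^ 2 := by
  intro u r φ a b c
  set s := Real.sqrt m
  have hs0 : s ≠ 0 := (Real.sqrt_pos.mpr hm).ne'
  have hsm : m = s ^ 2 := (Real.sq_sqrt hm.le).symm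
  have hFeq : F = fun p : ℝ × ℝ × ℝ =>
      ((p.2.1 / s) * Real.cosh (s * p.2.2) - (J / (2 * m)) * Real.sinh (s * p.2.2),
       (p.2.1 / s) * Real.sinh (s * p.2.2) - (J / (2 * m)) * Real.cosh (s * p.2.2),
       (1 / s) * (-p.2.1 + m * p.1 + J * p.2.2 / 2)) :=
    funext fun p => hF p.1 p.2.1 p.2.2
  have hdiff : DifferentiableAt ℝ F (u, r, φ) := by
    rw [hFeq]
    fun_prop
  have h (x y : ℝ) : HasDerivAt (fun t : ℝ => x + t * y) y 0 := by
    simpa using ((hasDerivAt_id (0 : ℝ)).mul_const y).const_add x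
  -- The Fréchet derivative along `(a, b, c)` is the velocity of the image of a straight line.
  have hline : HasDerivAt (fun t : ℝ => (u + t * a, r + t * b, φ + t * c)) (a, b, c) 0 :=
    (h u a).prodMk ((h r b).prodMk (h φ c))
  have hcomp : HasDerivAt (fun t : ℝ => F (u + t * a, r + t * b, φ + t * c))
      (fderiv ℝ F (u, r, φ) (a, b, c)) 0 := by
    refine HasFDerivAt.comp_hasDerivAt (0 : ℝ) ?_ hline
    simpa using hdiff.hasFDerivAt
  have hexplicit : HasDerivAt (fun t : ℝ => F (u + t * a, r + t * b, φ + t * c))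
      ((b / s - J * c / (2 * s)) * Real.cosh (s * φ) + r * c * Real.sinh (s * φ),
       (b / s - J * c / (2 * s)) * Real.sinh (s * φ) + r * c * Real.cosh (s * φ),
       (1 / s) * (-b + m * a + J * c / 2)) 0 := by
    have hr := (h r b).div_const s
    have hc := ((h φ c).const_mul s).cosh
    have hsh := ((h φ c).const_mul s).sinh
    simp only [hF]
    refine HasDerivAt.prodMk ?_ (HasDerivAt.prodMk ?_ ?_)
    · refine ((hr.mul hc).sub (hsh.const_mul (J / (2 * m)))).congr_deriv ?_
      simp only [zero_mul, add_zero, hsm]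
      field_simp
      ring
    · refine ((hr.mul hsh).sub (hc.const_mul (J / (2 * m)))).congr_deriv ?_
      simp only [zero_mul, add_zero, hsm]
      field_simp
      ring
    · exact (((h r b).neg.add ((h u a).const_mul m)).add
        (((h φ c).const_mul J).div_const 2)).const_mul (1 / s)
  rw [hcomp.unique hexplicit]
  have hcs := Real.cosh_sq (s * φ)
  simp only [hsm]
  field_simp
  ring_nf
  simp only [hcs]
  ring
end
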